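/- Let AT be an argumentation theory and A an argument from AT described by (G, R, p). If A is minimal (there is no G' strictly contained in G with G' ⊢_R p, and no R' strictly contained in R with G ⊢_{R'} p), then A is regular: no two distinct sub-arguments of A have the same conclusion. -/

import Mathlib

/-- A rule over the language `L`: a finite list of premises and a conclusion. -/
structure ArgRule (L : Type) where
  prems : List L
  concl : L

/-- An argumentation theory: a set of rules and a knowledge base. -/
structure ArgTheory (L : Type) where
  rules : Set (ArgRule L)
  kb : Set L

/-- Raw argument structures: either an element of the knowledge base, or an
application of a rule to a list of sub-arguments. -/
inductive Arg (L : Type) : Type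
  | atom (φ : L) : Arg L
  | node (children : List (Arg L)) (φ : L) : Arg L

namespace Arg

variable {L : Type}

/-- The conclusion of an argument. -/
def Conc : Arg L → L
  | .atom φ => φ
  | .node _ φ => φ

/-- The premises (grounds) of an argument. -/
def Prem : Arg L → Set L
  | .atom φ => {φ}
  | .node cs _ => cs.attach.foldr (fun c acc => Prem c.1 ∪ acc) ∅
decreasing_by have := List.sizeOf_lt_of_mem c.2; simp_wf; omega

/-- The set of rules used in an argument. -/
def Rules : Arg L → Set (ArgRule L)
  | .atom _ => ∅
  | .node cs φ =>
      insert ⟨cs.map Conc, φ⟩ (cs.attach.foldr (fun c acc => Rules c.1 ∪ acc) ∅)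
decreasing_by have := List.sizeOf_lt_of_mem c.2; simp_wf; omega

/-- The sub-arguments of an argument (including the argument itself). -/
def Sub : Arg L → Set (Arg L)
  | .atom φ => {.atom φ}
  | .node cs φ => insert (.node cs φ) (cs.attach.foldr (fun c acc => Sub c.1 ∪ acc) ∅)
decreasing_by have := List.sizeOf_lt_of_mem c.2; simp_wf; omega

/-- The top rule of an argument (undefined for atomic arguments). -/
def TopRule : Arg L → Option (ArgRule L)
  | .atom _ => none
  | .node cs φ => some ⟨cs.map Conc, φ⟩

/-- `A.IsArg AT` holds when `A` is a genuine argument of the theory `AT`. -/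
inductive IsArg (AT : ArgTheory L) : Arg L → Prop
  | atom {φ : L} : φ ∈ AT.kb → IsArg AT (.atom φ)
  | node {cs : List (Arg L)} {φ : L} :
      (∀ c ∈ cs, IsArg AT c) →
      (⟨cs.map Conc, φ⟩ : ArgRule L) ∈ AT.rules →
      IsArg AT (.node cs φ)

end Arg

/-- `Infers P R p` (written `P ⊢_R p`): `p` is in the closure of `P` under the
rules `R`, i.e. in the least set containing `P` and closed under `R`. -/
inductive Infers (P : Set L) (R : Set (ArgRule L)) : L → Prop
  | base {p : L} : p ∈ P → Infers P R p
  | step {r : ArgRule L} : r ∈ R → (∀ q ∈ r.prems, Infers P R q) →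
      Infers P R r.concl

namespace Arg

variable {L : Type}

/-- An argument `(G, R, p)` is minimal if no strict subset `G'` of `G` has
`G' ⊢_R p` and no strict subset `R'` of `R` has `G ⊢_{R'} p`. -/
def Minimal (A : Arg L) : Prop :=
  (¬ ∃ G' : Set L, G' ⊂ A.Prem ∧ Infers G' A.Rules A.Conc) ∧
  (¬ ∃ R' : Set (ArgRule L), R' ⊂ A.Rules ∧ Infers A.Prem R' A.Conc)

/-- An argument is regular if no two distinct sub-arguments share a conclusion. -/
def Regular (A : Arg L) : Prop :=
  ¬ ∃ A₁ ∈ A.Sub, ∃ A₂ ∈ A.Sub, A₁ ≠ A₂ ∧ A₁.Conc = A₂.Conc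

/-- An argument is circular if it has distinct sub-arguments with the same
conclusion, one of which is a sub-argument of the other. -/
def Circular (A : Arg L) : Prop :=
  ∃ A₁ ∈ A.Sub, ∃ A₂ ∈ A.Sub, A₁ ≠ A₂ ∧ A₁.Conc = A₂.Conc ∧ A₁ ∈ A₂.Sub

/-- An argument is redundant if it has distinct sub-arguments with the same
conclusion, neither of which is a sub-argument of the other. -/
def Redundant (A : Arg L) : Prop :=
  ∃ A₁ ∈ A.Sub, ∃ A₂ ∈ A.Sub, A₁ ≠ A₂ ∧ A₁.Conc = A₂.Conc ∧
    A₁ ∉ A₂.Sub ∧ A₂ ∉ A₁.Sub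

end Arg

namespace Infers

variable {L : Type} {P : Set L} {R R' : Set (ArgRule L)}

theorem mono_rules (h : R ⊆ R') {p : L} (hp : Infers P R p) : Infers P R' p := by
  induction hp with
  | base hp => exact .base hp
  | step hr _ ih => exact .step (h hr) ih

/-- Of two distinct rules with the same conclusion, at least one is not needed to infer it. -/
theorem diff_singleton_or {r₁ r₂ : ArgRule L} (h₁ : r₁ ∈ R) (h₂ : r₂ ∈ R) (hne : r₁ ≠ r₂)
    (hc : r₁.concl = r₂.concl) (h : Infers P R r₁.concl) :
    Infers P (R \ {r₁}) r₁.concl ∨ Infers P (R \ {r₂}) r₁.concl := by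
  by_contra! hcon
  have key : ∀ p, Infers P R p → Infers P (R \ {r₁, r₂}) p := by
    intro p hp
    induction hp with
    | base hp => exact .base hp
    | @step r hr _ ih =>
      by_cases hr₁ : r = r₁
      · subst hr₁
        exact (hcon.2 (.step ⟨hr, hne⟩ fun q hq => (ih q hq).mono_rules (by grind))).elim
      by_cases hr₂ : r = r₂
      · subst hr₂
        exact (hcon.1 (hc ▸ .step ⟨hr, hne.symm⟩
          fun q hq => (ih q hq).mono_rules (by grind))).elim
      exact .step ⟨hr, by simp [hr₁, hr₂]⟩ ih
  exact hcon.1 ((key _ h).mono_rules (by grind))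

end Infers

namespace Arg

variable {L : Type}

theorem induction_on_children {motive : Arg L → Prop} (atom : ∀ φ, motive (.atom φ))
    (node : ∀ cs φ, (∀ c ∈ cs, motive c) → motive (.node cs φ)) : ∀ A, motive A
  | .atom φ => atom φ
  | .node cs φ => node cs φ fun c _ => induction_on_children atom node c

theorem mem_foldr_union {α β : Type} (f : α → Set β) (l : List α) (x : β) :
    x ∈ l.foldr (fun c acc => f c ∪ acc) ∅ ↔ ∃ c ∈ l, x ∈ f c := by
  induction l with
  | nil => simp
  | cons a l ih => simp [ih]

theorem mem_prem_node {cs : List (Arg L)} {φ x : L} :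
    x ∈ (node cs φ).Prem ↔ ∃ c ∈ cs, x ∈ c.Prem := by
  rw [Prem, mem_foldr_union (fun c : {c // c ∈ cs} => Prem c.1)]
  simp

theorem mem_rules_node {cs : List (Arg L)} {φ : L} {r : ArgRule L} :
    r ∈ (node cs φ).Rules ↔ r = ⟨cs.map Conc, φ⟩ ∨ ∃ c ∈ cs, r ∈ c.Rules := by
  rw [Rules, Set.mem_insert_iff, mem_foldr_union (fun c : {c // c ∈ cs} => Rules c.1)]
  simp

theorem mem_sub_node {cs : List (Arg L)} {φ : L} {B : Arg L} :
    B ∈ (node cs φ).Sub ↔ B = node cs φ ∨ ∃ c ∈ cs, B ∈ c.Sub := by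
  rw [Sub, Set.mem_insert_iff, mem_foldr_union (fun c : {c // c ∈ cs} => Sub c.1)]
  simp

theorem prem_subset_of_mem_sub {A B : Arg L} (h : B ∈ A.Sub) : B.Prem ⊆ A.Prem := by
  induction A using induction_on_children with
  | atom φ => rw [Sub] at h; rw [Set.mem_singleton_iff.1 h]
  | node cs φ ih =>
    obtain rfl | ⟨c, hc, hB⟩ := mem_sub_node.1 h
    · rfl
    · exact fun x hx => mem_prem_node.2 ⟨c, hc, ih c hc hB hx⟩

theorem rules_subset_of_mem_sub {A B : Arg L} (h : B ∈ A.Sub) : B.Rules ⊆ A.Rules := by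
  induction A using induction_on_children with
  | atom φ => rw [Sub] at h; rw [Set.mem_singleton_iff.1 h]
  | node cs φ ih =>
    obtain rfl | ⟨c, hc, hB⟩ := mem_sub_node.1 h
    · rfl
    · exact fun x hx => mem_rules_node.2 (.inr ⟨c, hc, ih c hc hB hx⟩)

/-- The conclusion of an argument is inferred from its premises by any set of rules that
contains, or makes up for, each rule of the argument. -/
theorem infers_conc {A : Arg L} {P : Set L} {R : Set (ArgRule L)} (hP : A.Prem ⊆ P)
    (hR : ∀ r ∈ A.Rules, r ∈ R ∨ Infers P R r.concl) : Infers P R A.Conc := by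
  induction A using induction_on_children with
  | atom φ => exact .base (hP (by simp [Prem, Conc]))
  | node cs φ ih =>
    obtain h | h := hR _ (mem_rules_node.2 (.inl rfl))
    · refine .step h fun q hq => ?_
      obtain ⟨c, hc, rfl⟩ := List.mem_map.1 hq
      exact ih c hc (fun x hx => hP (mem_prem_node.2 ⟨c, hc, hx⟩))
        fun r hr => hR r (mem_rules_node.2 (.inr ⟨c, hc, hr⟩))
    · exact h

theorem infers_concl_of_mem_rules {A : Arg L} {r : ArgRule L} (hr : r ∈ A.Rules) :
    Infers A.Prem A.Rules r.concl := by
  suffices ∃ B ∈ A.Sub, B.Conc = r.concl by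
    obtain ⟨B, hB, hBr⟩ := this
    exact hBr ▸ infers_conc (prem_subset_of_mem_sub hB)
      fun s hs => .inl (rules_subset_of_mem_sub hB hs)
  induction A using induction_on_children with
  | atom φ => simp [Rules] at hr
  | node cs φ ih =>
    obtain rfl | ⟨c, hc, hrc⟩ := mem_rules_node.1 hr
    · exact ⟨_, mem_sub_node.2 (.inl rfl), rfl⟩
    · obtain ⟨B, hB, hBr⟩ := ih c hc hrc
      exact ⟨B, mem_sub_node.2 (.inr ⟨c, hc, hB⟩), hBr⟩

/-- An argument is determined by its conclusion within any set of premises and rules where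
each proposition is a premise or the conclusion of at most one rule, but not both. -/
theorem eq_of_conc_eq {G : Set L} {R : Set (ArgRule L)} (hG : ∀ r ∈ R, r.concl ∉ G)
    (hR : Set.InjOn ArgRule.concl R) {A B : Arg L} (hAG : A.Prem ⊆ G) (hAR : A.Rules ⊆ R)
    (hBG : B.Prem ⊆ G) (hBR : B.Rules ⊆ R) (h : A.Conc = B.Conc) : A = B := by
  induction A using induction_on_children generalizing B with
  | atom φ =>
    cases B with
    | atom ψ => exact congrArg atom h
    | node ds ψ =>
      exact (hG _ (hBR (mem_rules_node.2 (.inl rfl)))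
        (hAG (by simpa [Prem, Conc] using h.symm))).elim
  | node cs φ ih =>
    cases B with
    | atom ψ =>
      exact (hG _ (hAR (mem_rules_node.2 (.inl rfl)))
        (hBG (by simpa [Prem, Conc] using h))).elim
    | node ds ψ =>
      have hr := hR (hAR (mem_rules_node.2 (.inl rfl))) (hBR (mem_rules_node.2 (.inl rfl))) h
      obtain ⟨hcd, rfl⟩ := ArgRule.mk.inj hr
      congr 1
      have hlen : cs.length = ds.length := by simpa using congrArg List.length hcd
      refine List.ext_getElem hlen fun i hi hi' => ?_
      refine ih _ (List.getElem_mem hi)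
        (fun x hx => hAG (mem_prem_node.2 ⟨_, List.getElem_mem hi, hx⟩))
        (fun x hx => hAR (mem_rules_node.2 (.inr ⟨_, List.getElem_mem hi, hx⟩)))
        (fun x hx => hBG (mem_prem_node.2 ⟨_, List.getElem_mem hi', hx⟩))
        (fun x hx => hBR (mem_rules_node.2 (.inr ⟨_, List.getElem_mem hi', hx⟩))) ?_
      have := List.getElem_of_eq hcd (i := i) (by simpa using hi)
      simpa using this

theorem Minimal.not_infers_concl {A : Arg L} (hA : A.Minimal) {r : ArgRule L}
    (hr : r ∈ A.Rules) : ¬ Infers A.Prem (A.Rules \ {r}) r.concl := fun h =>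
  hA.2 ⟨A.Rules \ {r}, Set.sdiff_singleton_ssubset.2 hr, infers_conc subset_rfl fun s hs => by
    by_cases hsr : s = r
    · exact .inr (hsr ▸ h)
    · exact .inl ⟨hs, hsr⟩⟩

end Arg

/-- If an argument is minimal then it is regular. -/
theorem stmt_2 {L : Type} (AT : ArgTheory L) (A : Arg L) (hA : A.IsArg AT)
    (hmin : A.Minimal) : A.Regular := by
  rintro ⟨A₁, h₁, A₂, h₂, hne, hc⟩
  refine hne (Arg.eq_of_conc_eq (G := A.Prem) (R := A.Rules)
    (fun r hr hrG => hmin.not_infers_concl hr (.base hrG)) (fun r hr s hs hrs => ?_)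
    (Arg.prem_subset_of_mem_sub h₁) (Arg.rules_subset_of_mem_sub h₁)
    (Arg.prem_subset_of_mem_sub h₂) (Arg.rules_subset_of_mem_sub h₂) hc)
  by_contra hrs_ne
  obtain h | h := Infers.diff_singleton_or hr hs hrs_ne hrs (Arg.infers_concl_of_mem_rules hr)
  · exact hmin.not_infers_concl hr h
  · exact hmin.not_infers_concl hs (hrs ▸ h)
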